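/- Let m ≥ 2 and d = 2m + 1. Let T ∈ S^d ℂ³ be a nonzero ternary form of degree d, and let A ⊆ ℙ²(ℂ) be a non-redundant finite set computing T, with r = ℓ(A). If k_m(A) = min{ binom(m+2,2), r }, h_A(m+1) = r, and r ≤ binom(m+2,2) + ⌊m/2⌋, then T has rank r and T is identifiable (A is the unique set of cardinality r computing T). -/

import Mathlib

open MvPolynomial

noncomputable section

/-- Projective n-space over ℂ, viewed as classes of linear forms (vectors in ℂ^{n+1}). -/
abbrev Proj (n : ℕ) := Projectivization ℂ (Fin (n + 1) → ℂ)

instance (n : ℕ) : DecidableEq (Proj n) := Classical.decEq _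

/-- The linear form with coefficient vector `v`. -/
def linForm (n : ℕ) (v : Fin (n + 1) → ℂ) : MvPolynomial (Fin (n + 1)) ℂ :=
  ∑ i, MvPolynomial.C (v i) * MvPolynomial.X i

/-- The `d`-th Veronese image of a projective point: the `d`-th power of (a representative of)
the corresponding linear form. -/
def vero (n d : ℕ) (P : Proj n) : MvPolynomial (Fin (n + 1)) ℂ :=
  linForm n P.rep ^ d

/-- `A` computes `T` : the class of `T` lies in the projective linear span of `v_d(A)`,
equivalently `T` lies in the linear span of the `d`-th powers of the points of `A`. -/
def Computes (n d : ℕ) (A : Finset (Proj n)) (T : MvPolynomial (Fin (n + 1)) ℂ) : Prop :=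
  T ∈ Submodule.span ℂ (vero n d '' (A : Set (Proj n)))

/-- `A` is a non-redundant set computing `T`. -/
def NRComputes (n d : ℕ) (A : Finset (Proj n)) (T : MvPolynomial (Fin (n + 1)) ℂ) : Prop :=
  Computes n d A T ∧ ∀ A' ⊂ A, ¬ Computes n d A' T

/-- The (Waring) rank of `T` : minimal cardinality of a finite set computing `T`. -/
def waringRank (n d : ℕ) (T : MvPolynomial (Fin (n + 1)) ℂ) : ℕ :=
  sInf {r | ∃ A : Finset (Proj n), A.card = r ∧ Computes n d A T}

/-- `T` is identifiable: there is exactly one finite set computing `T` whose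
cardinality equals the rank of `T`. -/
def Identifiable (n d : ℕ) (T : MvPolynomial (Fin (n + 1)) ℂ) : Prop :=
  ∃! A : Finset (Proj n), A.card = waringRank n d T ∧ Computes n d A T

/-- The evaluation map of degree `j` on the chosen homogeneous coordinates of `Z`. -/
def evalMap (n j : ℕ) (Z : Finset (Proj n)) :
    MvPolynomial.homogeneousSubmodule (Fin (n + 1)) ℂ j →ₗ[ℂ] (Z → ℂ) where
  toFun F := fun P => MvPolynomial.eval (P.1).rep F.1
  map_add' F G := by funext P; simp
  map_smul' c F := by funext P; simp

/-- The Hilbert function of the finite set `Z` (at a natural number `j`). -/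
def hilbN (n : ℕ) (Z : Finset (Proj n)) (j : ℕ) : ℕ :=
  Module.finrank ℂ (LinearMap.range (evalMap n j Z))

/-- The Hilbert function of the finite set `Z` (zero in negative degrees). -/
def hilb (n : ℕ) (Z : Finset (Proj n)) (j : ℤ) : ℕ :=
  if j < 0 then 0 else hilbN n Z j.toNat

/-- The first difference of the Hilbert function. -/
def Dhilb (n : ℕ) (Z : Finset (Proj n)) (j : ℤ) : ℤ :=
  (hilb n Z j : ℤ) - (hilb n Z (j - 1) : ℤ)

/-- The `d`-th Kruskal rank of `A` : the largest `k` such that every subset of `A`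
with at most `k` elements has linearly independent image under `v_d`. -/
def kruskalRank (n d : ℕ) (A : Finset (Proj n)) : ℕ :=
  sSup {k | k ≤ A.card ∧
    ∀ A' ⊆ A, A'.card ≤ k → LinearIndependent ℂ (fun P : A' => vero n d P.1)}

/-- The Cayley–Bacharach property in degree `d` for the finite set `Z`. -/
def CB (n d : ℕ) (Z : Finset (Proj n)) : Prop :=
  ∀ P ∈ Z, ∀ F : MvPolynomial (Fin (n + 1)) ℂ, F.IsHomogeneous d →
    (∀ Q ∈ Z, Q ≠ P → MvPolynomial.eval Q.rep F = 0) → MvPolynomial.eval P.rep F = 0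

end



/-- Auxiliary grading map. -/
noncomputable def gradMap (n : ℕ) :
    MvPolynomial (Fin n) ℂ →ₐ[ℂ] Polynomial (MvPolynomial (Fin n) ℂ) :=
  aeval (fun i => Polynomial.C (X i) * Polynomial.X)

lemma gradMap_coeff (n : ℕ) (f : MvPolynomial (Fin n) ℂ) (i : ℕ) :
    (gradMap n f).coeff i = homogeneousComponent i f := by
  induction f using MvPolynomial.induction_on' with
  | monomial u a =>
    have h1 : gradMap n (monomial u a) = Polynomial.C (monomial u a) * Polynomial.X ^ u.degree := by
      rw [gradMap, aeval_monomial, Finsupp.prod_fintype _ _ (by simp)]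
      simp only [mul_pow, Finset.prod_mul_distrib]
      rw [Finset.prod_pow_eq_pow_sum, ← Finsupp.degree_eq_sum, ← mul_assoc]
      congr 1
      rw [monomial_eq, Finsupp.prod_fintype _ _ (by simp)]
      simp
    rw [h1, Polynomial.coeff_C_mul_X_pow]
    rw [homogeneousComponent_of_mem (isHomogeneous_monomial (R := ℂ) a rfl : IsHomogeneous (monomial u a) u.degree)]
  | add p q hp hq => simp [hp, hq]

lemma homog_of_mul {n d : ℕ} {f g : MvPolynomial (Fin n) ℂ} (h : (f * g).IsHomogeneous d)
    (hne : f * g ≠ 0) : ∃ a b, a + b = d ∧ f.IsHomogeneous a ∧ g.IsHomogeneous b := by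
  have hinj : ∀ p : MvPolynomial (Fin n) ℂ, p ≠ 0 → gradMap n p ≠ 0 := by
    intro p hp h0
    apply hp
    rw [← sum_homogeneousComponent p]
    apply Finset.sum_eq_zero
    intro i _
    rw [← gradMap_coeff, h0]; simp
  have hf := hinj f (left_ne_zero_of_mul hne)
  have hg := hinj g (right_ne_zero_of_mul hne)
  have hfg : gradMap n f * gradMap n g = Polynomial.C (f * g) * Polynomial.X ^ d := by
    rw [← map_mul]
    ext1 i
    rw [gradMap_coeff, homogeneousComponent_of_mem h, Polynomial.coeff_C_mul_X_pow]
  have h1 := Polynomial.natDegree_mul hf hg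
  have h2 := Polynomial.natTrailingDegree_mul hf hg
  rw [hfg, Polynomial.natDegree_C_mul_X_pow _ _ hne] at h1
  rw [hfg, Polynomial.C_mul_X_pow_eq_monomial, Polynomial.natTrailingDegree_monomial hne] at h2
  have h3 := (gradMap n f).natTrailingDegree_le_natDegree
  have h4 := (gradMap n g).natTrailingDegree_le_natDegree
  have key : ∀ p : MvPolynomial (Fin n) ℂ,
      (gradMap n p).natTrailingDegree = (gradMap n p).natDegree →
      p.IsHomogeneous (gradMap n p).natDegree := by
    intro p hp
    have : p = homogeneousComponent (gradMap n p).natDegree p := by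
      conv_lhs => rw [← sum_homogeneousComponent p]
      by_cases hmem : (gradMap n p).natDegree ∈ Finset.range (p.totalDegree + 1)
      · apply Finset.sum_eq_single_of_mem _ hmem
        intro b _ hb
        rw [← gradMap_coeff]
        rcases lt_or_gt_of_ne hb with hb | hb
        · exact Polynomial.coeff_eq_zero_of_lt_natTrailingDegree (hp ▸ hb)
        · exact Polynomial.coeff_eq_zero_of_natDegree_lt hb
      · rw [homogeneousComponent_eq_zero _ _ (by simpa using hmem)]
        apply Finset.sum_eq_zero
        intro b hb
        have hb : b < (gradMap n p).natDegree := by simp at hb hmem; omega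
        rw [← gradMap_coeff]
        exact Polynomial.coeff_eq_zero_of_lt_natTrailingDegree (hp ▸ hb)
    have h5 := homogeneousComponent_isHomogeneous (gradMap n p).natDegree p
    rwa [← this] at h5
  exact ⟨_, _, h1.symm, key f (by omega), key g (by omega)⟩

lemma quot_homog {n a b : ℕ} {f g : MvPolynomial (Fin n) ℂ} (hf : f.IsHomogeneous a)
    (hf0 : f ≠ 0) (h : (f * g).IsHomogeneous (a + b)) : g.IsHomogeneous b := by
  by_cases hg : g = 0
  · subst hg; exact isHomogeneous_zero _ _ _
  obtain ⟨a', b', h1, h2, h3⟩ := homog_of_mul h (mul_ne_zero hf0 hg)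
  have := h2.inj_right hf hf0
  have : b' = b := by omega
  exact this ▸ h3

instance homFin (n j : ℕ) : Module.Finite ℂ (homogeneousSubmodule (Fin n) ℂ j) :=
  Module.Finite.of_fg (homogeneousSubmodule_fg (Fin n) ℂ j)

lemma finrank_hom (n j : ℕ) :
    Module.finrank ℂ (homogeneousSubmodule (Fin (n + 1)) ℂ j) = (n + j).choose n := by
  have e1 : Module.finrank ℂ (homogeneousSubmodule (Fin (n + 1)) ℂ j)
      = Module.finrank ℂ (Finsupp.supported ℂ ℂ {d : Fin (n+1) →₀ ℕ | d.degree = j}) := by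
    have : homogeneousSubmodule (Fin (n + 1)) ℂ j = (Finsupp.supported ℂ ℂ {d : Fin (n+1) →₀ ℕ | d.degree = j}).comap (AddMonoidAlgebra.coeffLinearEquiv ℂ).toLinearMap := by
      rw [homogeneousSubmodule_eq_finsupp_supported]
      rfl
    rw [this]
    exact LinearEquiv.finrank_eq ((AddMonoidAlgebra.coeffLinearEquiv ℂ).submoduleMap _ |>.trans (LinearEquiv.ofEq _ _ (Submodule.map_comap_eq_of_surjective (AddMonoidAlgebra.coeffLinearEquiv ℂ).surjective _)))
  rw [e1, LinearEquiv.finrank_eq (Finsupp.supportedEquivFinsupp _)]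
  have hs : {d : Fin (n+1) →₀ ℕ | d.degree = j} = ↑(Finset.finsuppAntidiag (Finset.univ : Finset (Fin (n+1))) j) := by
    ext d; simp [Finsupp.degree_eq_sum]
  rw [hs, Module.finrank_finsupp_self]
  simp only [SetLike.coe_sort_coe, Fintype.card_coe]
  rw [Finset.card_finsuppAntidiag_nat_eq_choose]
  simp
  exact Nat.choose_symm_add.symm


/-- The Koszul-type map `(a, b) ↦ a F + b G`. -/
noncomputable def kosz {n k : ℕ} (i : ℕ) {F G : MvPolynomial (Fin n) ℂ} (hF : F.IsHomogeneous k)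
    (hG : G.IsHomogeneous k) :
    (homogeneousSubmodule (Fin n) ℂ i × homogeneousSubmodule (Fin n) ℂ i) →ₗ[ℂ]
      homogeneousSubmodule (Fin n) ℂ (i + k) where
  toFun p := ⟨p.1.1 * F + p.2.1 * G, (p.1.2.mul hF).add (p.2.2.mul hG)⟩
  map_add' p q := by ext1; simp; ring
  map_smul' c p := by ext1; simp

lemma finrank_kosz {n k : ℕ} (j : ℕ) {F G : MvPolynomial (Fin n) ℂ} (hF : F.IsHomogeneous k)
    (hG : G.IsHomogeneous k) (hG0 : G ≠ 0) (hrel : IsRelPrime F G) :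
    2 * Module.finrank ℂ (homogeneousSubmodule (Fin n) ℂ (j + k)) ≤
      Module.finrank ℂ (LinearMap.range (kosz (j + k) hF hG)) +
        Module.finrank ℂ (homogeneousSubmodule (Fin n) ℂ j) := by
  have h1 := (kosz (j + k) hF hG).finrank_range_add_finrank_ker
  rw [Module.finrank_prod] at h1
  have hker : ∀ p : LinearMap.ker (kosz (j + k) hF hG),
      ∃ c : homogeneousSubmodule (Fin n) ℂ j, p.1.1.1 = c.1 * G ∧ p.1.2.1 = - (c.1 * F) := by
    rintro ⟨⟨⟨a, ha⟩, ⟨b, hb⟩⟩, hp⟩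
    have hp' : a * F + b * G = 0 := by
      have := congrArg Subtype.val (LinearMap.mem_ker.1 hp)
      simpa [kosz] using this
    have hdvd : G ∣ a := by
      have : G ∣ a * F := ⟨-b, by linear_combination hp'⟩
      exact hrel.symm.dvd_of_dvd_mul_right this
    obtain ⟨c, rfl⟩ := hdvd
    refine ⟨⟨c, quot_homog hG hG0 (by rw [add_comm]; exact ha)⟩, by simp [mul_comm], ?_⟩
    have : G * (b + c * F) = 0 := by linear_combination hp'
    rcases mul_eq_zero.1 this with h | h
    · exact absurd h hG0
    · simp; linear_combination h
  -- the map c ↦ (cG, -cF)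
  let ψ : homogeneousSubmodule (Fin n) ℂ j →ₗ[ℂ]
      (homogeneousSubmodule (Fin n) ℂ (j + k) × homogeneousSubmodule (Fin n) ℂ (j + k)) :=
    { toFun := fun c => (⟨c.1 * G, c.2.mul hG⟩, ⟨-(c.1 * F), (c.2.mul hF).neg⟩)
      map_add' := by intro p q; ext1 <;> ext1 <;> simp <;> ring
      map_smul' := by intro c p; ext1 <;> ext1 <;> simp }
  have hle : LinearMap.ker (kosz (j + k) hF hG) ≤ LinearMap.range ψ := by
    intro p hp
    obtain ⟨c, h1, h2⟩ := hker ⟨p, hp⟩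
    refine ⟨c, ?_⟩
    ext1 <;> ext1
    · exact h1.symm
    · exact h2.symm
  have h2 := Submodule.finrank_mono hle
  have h3 := LinearMap.finrank_range_le ψ
  omega

/-- Binary case: relatively prime forms of degree `k` generate everything in degree `≥ 2k`. -/
lemma binary_gen {k : ℕ} (j : ℕ) {F G : MvPolynomial (Fin 2) ℂ} (hF : F.IsHomogeneous k)
    (hG : G.IsHomogeneous k) (hG0 : G ≠ 0) (hrel : IsRelPrime F G) 
    {H : MvPolynomial (Fin 2) ℂ} (hH : H.IsHomogeneous (j + k + k)) :
    ∃ a b : MvPolynomial (Fin 2) ℂ, a.IsHomogeneous (j + k) ∧ b.IsHomogeneous (j + k) ∧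
      H = a * F + b * G := by
  have h := finrank_kosz j hF hG hG0 hrel
  have e : ∀ i, Module.finrank ℂ (homogeneousSubmodule (Fin 2) ℂ i) = i + 1 := by
    intro i; rw [finrank_hom 1 i, Nat.choose_one_right, add_comm]
  have htop : LinearMap.range (kosz (j + k) hF hG) = ⊤ := by
    apply Submodule.eq_top_of_finrank_eq
    apply le_antisymm (Submodule.finrank_le _)
    rw [e] at h ⊢
    rw [e] at h
    omega
  have : (⟨H, hH⟩ : homogeneousSubmodule (Fin 2) ℂ (j + k + k)) ∈
      LinearMap.range (kosz (j + k) hF hG) := htop ▸ Submodule.mem_top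
  obtain ⟨⟨a, b⟩, hab⟩ := this
  exact ⟨a.1, b.1, a.2, b.2, (congrArg Subtype.val hab).symm⟩

/-- Binary forms without common zeros are relatively prime. -/
lemma binary_relPrime {F G : MvPolynomial (Fin 2) ℂ}
    (hz : ∀ v : Fin 2 → ℂ, eval v F = 0 → eval v G = 0 → v = 0) : IsRelPrime F G := by
  intro p hpF hpG
  have hrad : ∀ i : Fin 2, ∃ N, (X i : MvPolynomial (Fin 2) ℂ) ^ N ∈ Ideal.span {F, G} := by
    intro i
    have : (X i : MvPolynomial (Fin 2) ℂ) ∈ (Ideal.span {F, G}).radical := by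
      rw [← vanishingIdeal_zeroLocus_eq_radical (k := ℂ) (K := ℂ), mem_vanishingIdeal_iff]
      intro x hx
      rw [mem_zeroLocus_iff] at hx
      have h1 := hx F (Ideal.subset_span (by simp))
      have h2 := hx G (Ideal.subset_span (by simp))
      rw [aeval_eq_eval] at h1 h2
      have := hz x h1 h2
      simp [this]
    exact this
  have hdvd : ∀ q ∈ Ideal.span {F, G}, p ∣ q := by
    intro q hq
    obtain ⟨a, b, rfl⟩ := Ideal.mem_span_pair.1 hq
    exact dvd_add (hpF.mul_left a) (hpG.mul_left b)
  obtain ⟨N0, h0⟩ := hrad 0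
  obtain ⟨N1, h1⟩ := hrad 1
  have hr : IsRelPrime ((X 0 : MvPolynomial (Fin 2) ℂ) ^ N0) ((X 1) ^ N1) := by
    apply IsRelPrime.pow
    have hp0 : Prime (X 0 : MvPolynomial (Fin 2) ℂ) := X_prime
    have : Irreducible (X 0 : MvPolynomial (Fin 2) ℂ) := hp0.irreducible
    rw [this.isRelPrime_iff_not_dvd]
    rw [X_dvd_X]
    simp
  exact hr (hdvd _ h0) (hdvd _ h1)

lemma not_isUnit_homog {n k : ℕ} (hk : 1 ≤ k) {F : MvPolynomial (Fin n) ℂ}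
    (hF : F.IsHomogeneous k) : ¬ IsUnit F := by
  intro h
  have := hF.totalDegree h.ne_zero
  obtain ⟨c, hc, rfl⟩ := MvPolynomial.isUnit_iff_eq_C_of_isReduced.1 h
  simp at this
  omega


/-- Forms of degree `j` separate the points of `W`. -/
def Separ (j : ℕ) (W : Finset (Proj 2)) : Prop :=
  ∀ P ∈ W, ∃ H : MvPolynomial (Fin 3) ℂ, H.IsHomogeneous j ∧ eval P.rep H ≠ 0 ∧
    ∀ Q ∈ W, Q ≠ P → eval Q.rep H = 0

lemma eval_linForm (a v : Fin 3 → ℂ) : eval v (linForm 2 a) = ∑ i, a i * v i := by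
  simp [linForm]

lemma linForm_homog (a : Fin 3 → ℂ) : (linForm 2 a).IsHomogeneous 1 :=
  IsHomogeneous.sum _ _ _ fun i _ => isHomogeneous_C_mul_X _ _

lemma eval_smul_homog {n j : ℕ} {H : MvPolynomial (Fin n) ℂ} (hH : H.IsHomogeneous j) (c : ℂ)
    (v : Fin n → ℂ) : eval (c • v) H = c ^ j * eval v H := by
  rw [eval_eq, eval_eq, Finset.mul_sum]
  apply Finset.sum_congr rfl
  intro d hd
  have hdeg : d.degree = j := by
    by_contra h
    exact (mem_support_iff.1 hd) (hH.coeff_eq_zero h)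
  simp only [Pi.smul_apply, smul_eq_mul, mul_pow, Finset.prod_mul_distrib]
  rw [Finset.prod_pow_eq_pow_sum]
  have : ∑ i ∈ d.support, d i = j := hdeg
  rw [this]; ring

lemma eval_rep_mk {j : ℕ} {H : MvPolynomial (Fin 3) ℂ} (hH : H.IsHomogeneous j)
    (v : Fin 3 → ℂ) (hv : v ≠ 0) (h : eval v H = 0) :
    eval (Projectivization.mk ℂ v hv).rep H = 0 := by
  obtain ⟨c, hc⟩ := Projectivization.exists_smul_eq_mk_rep ℂ v hv
  rw [← hc]
  have : (c • v : Fin 3 → ℂ) = (c : ℂ) • v := rfl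
  rw [this, eval_smul_homog hH, h, mul_zero]

lemma exists_lin_sep (P Q : Proj 2) (h : Q ≠ P) :
    ∃ a : Fin 3 → ℂ, eval P.rep (linForm 2 a) ≠ 0 ∧ eval Q.rep (linForm 2 a) = 0 := by
  have hn : P.rep ∉ Submodule.span ℂ {Q.rep} := by
    intro hmem
    obtain ⟨c, hc⟩ := Submodule.mem_span_singleton.1 hmem
    apply h
    rw [← Projectivization.mk_rep P, ← Projectivization.mk_rep Q]
    rw [eq_comm, Projectivization.mk_eq_mk_iff']
    exact ⟨c, hc⟩
  obtain ⟨f, hf, hf2⟩ := Submodule.exists_le_ker_of_notMem hn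
  have hrepr : ∀ v : Fin 3 → ℂ, eval v (linForm 2 (fun i => f (Pi.single i 1))) = f v := by
    intro v
    rw [eval_linForm]
    conv_rhs => rw [LinearMap.pi_apply_eq_sum_univ f v]
    apply Finset.sum_congr rfl
    intro i _
    rw [smul_eq_mul, mul_comm]
    congr 2
    ext j; simp [Pi.single_apply, eq_comm]
  refine ⟨fun i => f (Pi.single i 1), ?_, ?_⟩
  · rw [hrepr]; exact hf
  · rw [hrepr]; exact hf2 (Submodule.mem_span_singleton_self _)

lemma exists_lin_ne (P : Proj 2) : ∃ a : Fin 3 → ℂ, eval P.rep (linForm 2 a) ≠ 0 := by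
  by_contra! h
  apply P.rep_nonzero
  ext i
  have := h (Pi.single i 1)
  rw [eval_linForm] at this
  simpa [Pi.single_apply] using this

lemma sep_up {j : ℕ} {W : Finset (Proj 2)} (h : Separ j W) (i : ℕ) : Separ (j + i) W := by
  intro P hP
  obtain ⟨H, h1, h2, h3⟩ := h P hP
  obtain ⟨a, ha⟩ := exists_lin_ne P
  refine ⟨H * linForm 2 a ^ i, ?_, ?_, ?_⟩
  · have := h1.mul ((linForm_homog a).pow i)
    simpa using this
  · simp [h2, ha]
  · intro Q hQ hne; simp [h3 Q hQ hne]

lemma sep_mono {j : ℕ} {W W' : Finset (Proj 2)} (h : Separ j W) (hs : W' ⊆ W) : Separ j W' := by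
  intro P hP
  obtain ⟨H, h1, h2, h3⟩ := h P (hs hP)
  exact ⟨H, h1, h2, fun Q hQ => h3 Q (hs hQ)⟩

lemma sep_card (W : Finset (Proj 2)) : Separ W.card W := by
  intro P hP
  have : ∀ Q : Proj 2, ∃ a : Fin 3 → ℂ, eval P.rep (linForm 2 a) ≠ 0 ∧
      (Q ≠ P → eval Q.rep (linForm 2 a) = 0) := by
    intro Q
    by_cases h : Q = P
    · obtain ⟨a, ha⟩ := exists_lin_ne P
      exact ⟨a, ha, fun h' => absurd h h'⟩
    · obtain ⟨a, ha, hb⟩ := exists_lin_sep P Q h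
      exact ⟨a, ha, fun _ => hb⟩
  choose a ha hb using this
  refine ⟨∏ Q ∈ W, linForm 2 (a Q), ?_, ?_, ?_⟩
  · have := IsHomogeneous.prod W (fun Q => linForm 2 (a Q)) (fun _ => 1)
      (fun Q _ => linForm_homog (a Q))
    simpa using this
  · rw [map_prod]; exact Finset.prod_ne_zero_iff.2 fun Q _ => ha Q
  · intro Q hQ hne
    rw [map_prod]; exact Finset.prod_eq_zero hQ (hb Q hne)

lemma sep_surj {j : ℕ} {W : Finset (Proj 2)} (h : Separ j W) :
    Function.Surjective (evalMap 2 j W) := by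
  choose! H h1 h2 h3 using h
  intro f
  have hm : ∀ P : W, H P.1 ∈ homogeneousSubmodule (Fin 3) ℂ j := fun P => h1 P.1 P.2
  refine ⟨∑ P : W, (f P / eval P.1.rep (H P.1)) • ⟨H P.1, hm P⟩, ?_⟩
  rw [map_sum]
  ext Q
  rw [Finset.sum_apply, Finset.sum_eq_single Q]
  · have := h2 Q.1 Q.2
    simp [evalMap, this]
  · intro P _ hne
    have := h3 P.1 P.2 Q.1 Q.2 (fun h => hne (Subtype.ext h).symm)
    simp [evalMap, this]
  · simp

lemma finrank_ker_of_sep {j : ℕ} {W : Finset (Proj 2)} (h : Separ j W) :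
    W.card + Module.finrank ℂ (LinearMap.ker (evalMap 2 j W)) = (j + 2).choose 2 := by
  have h1 := (evalMap 2 j W).finrank_range_add_finrank_ker
  rw [LinearMap.range_eq_top.2 (sep_surj h), finrank_top, finrank_hom 2 j] at h1
  rw [add_comm j 2, ← h1]
  simp

lemma finrank_ker_ge (j : ℕ) (W : Finset (Proj 2)) :
    (j + 2).choose 2 ≤ W.card + Module.finrank ℂ (LinearMap.ker (evalMap 2 j W)) := by
  have h1 := (evalMap 2 j W).finrank_range_add_finrank_ker
  rw [finrank_hom 2 j] at h1
  have h2 := Submodule.finrank_le (LinearMap.range (evalMap 2 j W))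
  simp at h2
  rw [add_comm j 2, ← h1]
  omega

lemma choose_two_id (n : ℕ) : 2 * (n + 2).choose 2 = (n + 2) * (n + 1) := by
  rw [Nat.choose_two_right]
  simp
  exact Nat.mul_div_cancel' (Nat.even_mul_pred_self (n + 2)).two_dvd

lemma finite_zeros {k : ℕ} {F G : MvPolynomial (Fin 3) ℂ} (hF : F.IsHomogeneous k)
    (hG : G.IsHomogeneous k) (hG0 : G ≠ 0) (hrel : IsRelPrime F G) :
    {P : Proj 2 | eval P.rep F = 0 ∧ eval P.rep G = 0}.Finite := by
  by_contra hinf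
  obtain ⟨W, hW, hcard⟩ := Set.Infinite.exists_subset_card_eq hinf (k * k + 1)
  have hs := sep_up (sep_card W) (k + k)
  have h1 := finrank_ker_of_sep hs
  rw [← add_assoc] at h1
  set j := W.card
  have h2 := finrank_kosz j hF hG hG0 hrel
  have hle : LinearMap.range (kosz (j + k) hF hG) ≤ LinearMap.ker (evalMap 2 (j + k + k) W) := by
    rintro _ ⟨⟨a, b⟩, rfl⟩
    rw [LinearMap.mem_ker]
    ext P
    have := hW P.2
    simp at this
    simp [evalMap, kosz, this.1, this.2]
  have h3 := Submodule.finrank_mono hle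
  rw [← add_assoc] at hs
  rw [finrank_hom 2, finrank_hom 2, add_comm 2, add_comm 2] at h2
  have c1 := choose_two_id (j + k + k)
  have c2 := choose_two_id (j + k)
  have c3 := choose_two_id j
  have h4 : 2 * (j + k + 2).choose 2 ≤ Module.finrank ℂ (LinearMap.ker (evalMap 2 (j + k + k) W)) +
      (j + 2).choose 2 := h2.trans (Nat.add_le_add_right h3 _)
  have : W.card + (2 * (j + k + 2).choose 2) ≤ (j + k + k + 2).choose 2 + (j + 2).choose 2 := by
    omega
  nlinarith

lemma exists_avoid {Y : Set (Proj 2)} (hY : Y.Finite) :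
    ∃ a : Fin 3 → ℂ, ∀ P ∈ Y, eval P.rep (linForm 2 a) ≠ 0 := by
  have : Finite Y := hY
  let p : Y → Subspace ℂ (Fin 3 → ℂ) := fun P =>
    LinearMap.ker (∑ i : Fin 3, P.1.rep i • (LinearMap.proj i : (Fin 3 → ℂ) →ₗ[ℂ] ℂ))
  have hp : ∀ P : Y, ∀ a, a ∈ p P ↔ eval P.1.rep (linForm 2 a) = 0 := by
    intro P a
    rw [eval_linForm]
    simp [p, mul_comm]
  by_contra! hcon
  have hcov : ⋃ i, (p i : Set (Fin 3 → ℂ)) = Set.univ := by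
    rw [Set.eq_univ_iff_forall]
    intro a
    obtain ⟨P, hP, h⟩ := hcon a
    exact Set.mem_iUnion.2 ⟨⟨P, hP⟩, (hp ⟨P, hP⟩ a).2 h⟩
  obtain ⟨P, hP⟩ := Subspace.exists_eq_top_of_iUnion_eq_univ hcov
  obtain ⟨a, ha⟩ := exists_lin_ne P.1
  exact ha ((hp P a).1 (hP ▸ Submodule.mem_top))

/-- Restriction to the line `z = α x + β y`. -/
noncomputable def resL (α β : ℂ) : MvPolynomial (Fin 3) ℂ →ₐ[ℂ] MvPolynomial (Fin 2) ℂ :=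
  aeval ![X 0, X 1, C α * X 0 + C β * X 1]

/-- Inclusion of binary forms in ternary forms. -/
noncomputable def incL : MvPolynomial (Fin 2) ℂ →ₐ[ℂ] MvPolynomial (Fin 3) ℂ :=
  aeval ![X 0, X 1]

lemma resL_incL (α β : ℂ) (f : MvPolynomial (Fin 2) ℂ) : resL α β (incL f) = f := by
  have : (resL α β).comp incL = AlgHom.id ℂ _ := by
    ext i : 1
    fin_cases i <;> simp [resL, incL]
  exact DFunLike.congr_fun this f

lemma resL_homog (α β : ℂ) {j : ℕ} {f : MvPolynomial (Fin 3) ℂ} (hf : f.IsHomogeneous j) :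
    (resL α β f).IsHomogeneous j := by
  have := hf.aeval (S := ℂ) (τ := Fin 2) (n := 1) ![X 0, X 1, C α * X 0 + C β * X 1] (by
    intro i
    fin_cases i
    · exact isHomogeneous_X _ _
    · exact isHomogeneous_X _ _
    · exact (isHomogeneous_C_mul_X _ _).add (isHomogeneous_C_mul_X _ _))
  rw [one_mul] at this
  exact this

lemma incL_homog {j : ℕ} {f : MvPolynomial (Fin 2) ℂ} (hf : f.IsHomogeneous j) :
    (incL f).IsHomogeneous j := by
  have := hf.aeval (S := ℂ) (τ := Fin 3) (n := 1) ![X 0, X 1] (by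
    intro i
    fin_cases i
    · exact isHomogeneous_X _ _
    · exact isHomogeneous_X _ _)
  rw [one_mul] at this
  exact this

lemma resL_ker (α β : ℂ) (f : MvPolynomial (Fin 3) ℂ) (hf : resL α β f = 0) :
    (X 2 - (C α * X 0 + C β * X 1)) ∣ f := by
  set l : MvPolynomial (Fin 3) ℂ := X 2 - (C α * X 0 + C β * X 1) with hl
  have : (Ideal.Quotient.mkₐ ℂ (Ideal.span {l})).comp (incL.comp (resL α β)) =
      Ideal.Quotient.mkₐ ℂ (Ideal.span {l}) := by
    ext i : 1
    fin_cases i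
    · simp [resL, incL]
    · simp [resL, incL]
    · simp only [Fin.reduceFinMk, AlgHom.comp_apply, Ideal.Quotient.mkₐ_eq_mk]
      rw [eq_comm, Ideal.Quotient.eq, Ideal.mem_span_singleton]
      simp [resL, incL, hl, MvPolynomial.algebraMap_eq]
  have h := DFunLike.congr_fun this f
  simp only [AlgHom.comp_apply, hf, map_zero, Ideal.Quotient.mkₐ_eq_mk] at h
  exact Ideal.mem_span_singleton.1 (Ideal.Quotient.eq_zero_iff_mem.1 h.symm)

lemma eval_resL (α β : ℂ) (v : Fin 2 → ℂ) (f : MvPolynomial (Fin 3) ℂ) :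
    eval v (resL α β f) = eval ![v 0, v 1, α * v 0 + β * v 1] f := by
  have : (aeval v : _ →ₐ[ℂ] ℂ).comp (resL α β) = aeval ![v 0, v 1, α * v 0 + β * v 1] := by
    ext i
    fin_cases i <;> simp [resL]
  exact DFunLike.congr_fun this f

/-- Points in a complete intersection of type `(k, k)` are separated in degree `≥ 2k - 1`. -/
lemma sep_of_ci {k : ℕ} (hk : 1 ≤ k) {F G : MvPolynomial (Fin 3) ℂ} (hF : F.IsHomogeneous k)
    (hG : G.IsHomogeneous k) (hG0 : G ≠ 0) (hrel : IsRelPrime F G) (W : Finset (Proj 2))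
    (hW : ∀ P ∈ W, eval P.rep F = 0 ∧ eval P.rep G = 0) (t : ℕ) (ht : 2 * k ≤ t + 1) :
    Separ t W := by
  have hfin := finite_zeros hF hG hG0 hrel
  have hv0 : (![0, 0, 1] : Fin 3 → ℂ) ≠ 0 := fun h => by
    have := congrFun h 2
    simp at this
  obtain ⟨a, ha⟩ := exists_avoid
    (hfin.union (Set.finite_singleton (Projectivization.mk ℂ (![0, 0, 1] : Fin 3 → ℂ) hv0)))
  have ha2 : a 2 ≠ 0 := by
    intro h
    apply ha _ (Or.inr rfl)
    apply eval_rep_mk (linForm_homog a)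
    rw [eval_linForm, Fin.sum_univ_three]
    simp [h]
  set α := -(a 0 / a 2) with hα
  set β := -(a 1 / a 2) with hβ
  set l : MvPolynomial (Fin 3) ℂ := X 2 - (C α * X 0 + C β * X 1) with hl
  have hlh : l.IsHomogeneous 1 :=
    (isHomogeneous_X _ _).sub ((isHomogeneous_C_mul_X _ _).add (isHomogeneous_C_mul_X _ _))
  have hl0 : l ≠ 0 := by
    intro h
    have := congrArg (eval ![0, 0, 1]) h
    simp [hl] at this
  have hlz : ∀ P : Proj 2, eval P.rep F = 0 → eval P.rep G = 0 → eval P.rep l ≠ 0 := by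
    intro P h1 h2 h3
    apply ha P (Or.inl ⟨h1, h2⟩)
    rw [eval_linForm, Fin.sum_univ_three]
    simp [hl, hα, hβ] at h3
    field_simp at h3
    linear_combination h3
  set f := resL α β F with hf
  set g := resL α β G with hg
  have hrel2 : IsRelPrime f g := by
    apply binary_relPrime
    intro v h1 h2
    rw [hf, eval_resL] at h1
    rw [hg, eval_resL] at h2
    by_contra hv
    have hw : (![v 0, v 1, α * v 0 + β * v 1] : Fin 3 → ℂ) ≠ 0 := by
      intro h
      apply hv
      ext i
      fin_cases i
      · exact congrFun h 0
      · exact congrFun h 1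
    refine hlz (Projectivization.mk ℂ _ hw) (eval_rep_mk hF _ hw h1) (eval_rep_mk hG _ hw h2)
      (eval_rep_mk hlh _ hw ?_)
    simp [hl]
  have hfh : f.IsHomogeneous k := resL_homog _ _ hF
  have hgh : g.IsHomogeneous k := resL_homog _ _ hG
  have hg0 : g ≠ 0 := by
    intro h
    rw [h] at hrel2
    exact not_isUnit_homog hk hfh (isRelPrime_zero_right.1 hrel2)
  have down : ∀ j, 2 * k ≤ j + 1 → Separ (j + 1) W → Separ j W := by
    intro j hj hs P hP
    obtain ⟨H, h1, h2, h3⟩ := hs P hP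
    obtain ⟨i, hi⟩ : ∃ i, j + 1 = i + k + k := ⟨j + 1 - 2 * k, by omega⟩
    obtain ⟨a, b, ha, hb, hab⟩ := binary_gen i hfh hgh hg0 hrel2
      (H := resL α β H) (hi ▸ resL_homog _ _ h1)
    have hz : resL α β (H - (incL a * F + incL b * G)) = 0 := by
      rw [map_sub, map_add, map_mul, map_mul, resL_incL, resL_incL, hab]
      simp [hf, hg]
    obtain ⟨q, hq⟩ := resL_ker α β _ hz
    rw [← hl] at hq
    have hqh : q.IsHomogeneous j := by
      apply quot_homog hlh hl0
      rw [← hq, add_comm 1 j]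
      apply h1.sub
      rw [hi]
      exact ((incL_homog ha).mul hF).add ((incL_homog hb).mul hG)
    have hev : ∀ Q ∈ W, eval Q.rep H = eval Q.rep l * eval Q.rep q := by
      intro Q hQ
      have := congrArg (eval Q.rep) hq
      simpa [(hW Q hQ).1, (hW Q hQ).2] using this
    refine ⟨q, hqh, ?_, ?_⟩
    · intro h0; apply h2; rw [hev P hP, h0, mul_zero]
    · intro Q hQ hne
      have := h3 Q hQ hne
      rw [hev Q hQ] at this
      exact (mul_eq_zero.1 this).resolve_left (hlz Q (hW Q hQ).1 (hW Q hQ).2)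
  have hbig := sep_up (sep_card W) t
  rw [add_comm] at hbig
  have : ∀ i, Separ (t + i) W → Separ t W := by
    intro i
    induction i with
    | zero => exact id
    | succ i ih => intro h; exact ih (down (t + i) (by omega) h)
  exact this _ hbig


lemma coeff_vero (d : ℕ) (P : Proj 2) (s : Fin 3 →₀ ℕ) :
    coeff s (vero 2 d P) = if s.sum (fun _ m ↦ m) = d then
      (s.multinomial : ℂ) * s.prod (fun r m ↦ P.rep r ^ m) else 0 := by
  rw [← coeff_linearCombination_X_pow_of_fintype]
  simp only [vero, linForm, smul_eq_C_mul]

lemma vero_rel_iff (d : ℕ) (A : Finset (Proj 2)) (c : Proj 2 → ℂ) :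
    ∑ P ∈ A, c P • vero 2 d P = 0 ↔
      ∀ H : MvPolynomial (Fin 3) ℂ, H.IsHomogeneous d → ∑ P ∈ A, c P * eval P.rep H = 0 := by
  have hco : ∀ s : Fin 3 →₀ ℕ, s.sum (fun _ m ↦ m) = d →
      coeff s (∑ P ∈ A, c P • vero 2 d P) =
        s.multinomial * ∑ P ∈ A, c P * s.prod (fun r m ↦ P.rep r ^ m) := by
    intro s hs
    rw [coeff_sum, Finset.mul_sum]
    apply Finset.sum_congr rfl
    intro P _
    rw [coeff_smul, coeff_vero, if_pos hs, smul_eq_mul]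
    ring
  constructor
  · intro h H hH
    have hz : ∀ s ∈ H.support, ∑ P ∈ A, c P * s.prod (fun r m ↦ P.rep r ^ m) = 0 := by
      intro s hs
      have hdeg : s.degree = d := by
        by_contra h
        exact (mem_support_iff.1 hs) (hH.coeff_eq_zero h)
      have h1 := hco s hdeg
      rw [h, coeff_zero] at h1
      have h2 : (s.multinomial : ℂ) ≠ 0 := by
        rw [Finsupp.multinomial_eq]
        exact_mod_cast (Nat.multinomial_pos _ _).ne'
      exact (mul_eq_zero.1 h1.symm).resolve_left h2
    simp_rw [eval_eq, Finset.mul_sum]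
    rw [Finset.sum_comm]
    apply Finset.sum_eq_zero
    intro s hs
    calc _ = coeff s H * ∑ P ∈ A, c P * s.prod (fun r m ↦ P.rep r ^ m) := by
          rw [Finset.mul_sum]
          apply Finset.sum_congr rfl
          intro P _
          rw [Finsupp.prod]
          ring
      _ = 0 := by rw [hz s hs, mul_zero]
  · intro h
    ext s
    by_cases hs : s.sum (fun _ m ↦ m) = d
    · rw [hco s hs, coeff_zero]
      have := h (monomial s 1) (isHomogeneous_monomial _ hs)
      simp only [eval_monomial, one_mul] at this
      rw [this, mul_zero]
    · rw [coeff_sum, coeff_zero]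
      apply Finset.sum_eq_zero
      intro P _
      rw [coeff_smul, coeff_vero, if_neg hs, smul_zero]

lemma computes_iff (d : ℕ) (A : Finset (Proj 2)) (T : MvPolynomial (Fin 3) ℂ) :
    Computes 2 d A T ↔ ∃ c : Proj 2 → ℂ, ∑ P ∈ A, c P • vero 2 d P = T := by
  rw [Computes, Submodule.mem_span_image_finset_iff_exists_fun ℂ]
  constructor
  · rintro ⟨c, hc⟩
    refine ⟨fun P => if h : P ∈ A then c ⟨P, h⟩ else 0, ?_⟩
    rw [← Finset.sum_coe_sort, ← hc]
    apply Finset.sum_congr rfl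
    intro P _
    simp
  · rintro ⟨c, hc⟩
    refine ⟨fun P => c P.1, ?_⟩
    rw [← hc]
    exact Finset.sum_coe_sort A (fun P => c P • vero 2 d P)

lemma separ_of_surj {j : ℕ} {W : Finset (Proj 2)}
    (h : Function.Surjective (evalMap 2 j W)) : Separ j W := by
  intro P hP
  obtain ⟨H, hH⟩ := h (Pi.single ⟨P, hP⟩ 1)
  refine ⟨H.1, H.2, ?_, ?_⟩
  · have := congrFun hH ⟨P, hP⟩
    have h2 : eval P.rep H.1 = 1 := by simpa [evalMap] using this
    rw [h2]; exact one_ne_zero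
  · intro Q hQ hne
    have := congrFun hH ⟨Q, hQ⟩
    simpa [evalMap, Pi.single_apply, hne] using this

lemma separ_of_hilb {j : ℕ} {W : Finset (Proj 2)} (h : hilbN 2 W j = W.card) : Separ j W := by
  apply separ_of_surj
  rw [← LinearMap.range_eq_top]
  apply Submodule.eq_top_of_finrank_eq
  rw [hilbN] at h
  rw [h]; simp

lemma separ_of_linInd {j : ℕ} {W : Finset (Proj 2)}
    (h : LinearIndependent ℂ (fun P : W => vero 2 j P.1)) : Separ j W := by
  apply separ_of_surj
  rw [← LinearMap.range_eq_top]
  by_contra hne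
  obtain ⟨f, hf0, hf⟩ := Submodule.exists_le_ker_of_lt_top _ (lt_top_iff_ne_top.2 hne)
  apply hf0
  have hrepr : ∀ w : W → ℂ, f w = ∑ P, w P * f (Pi.single P 1) := by
    intro w
    conv_lhs => rw [LinearMap.pi_apply_eq_sum_univ f w]
    apply Finset.sum_congr rfl
    intro i _
    rw [smul_eq_mul]
    congr 2
    ext j; simp [Pi.single_apply, eq_comm]
  let c : Proj 2 → ℂ := fun P => if h : P ∈ W then f (Pi.single ⟨P, h⟩ 1) else 0
  have hc : ∀ P : W, c P.1 = f (Pi.single P 1) := fun P => by simp [c]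
  have hrel : ∑ P ∈ W, c P • vero 2 j P = 0 := by
    rw [vero_rel_iff]
    intro H hH
    have h1 : f (evalMap 2 j W ⟨H, hH⟩) = 0 := hf (LinearMap.mem_range_self _ _)
    rw [hrepr] at h1
    rw [← Finset.sum_coe_sort]
    rw [← h1]
    apply Finset.sum_congr rfl
    intro P _
    rw [hc, mul_comm]
    rfl
  rw [← Finset.sum_coe_sort] at hrel
  have hz := Fintype.linearIndependent_iff.1 h (fun P => c P.1) hrel
  ext P
  have := hz P
  simp only [hc] at this
  simpa using this

/-- If all forms of degree `m + 1` through `A` vanish at `Q`, then `Q ∈ A`. -/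
lemma mem_of_vanish {m : ℕ} {A : Finset (Proj 2)} (hA : Separ m A) (Q : Proj 2)
    (h : ∀ H : MvPolynomial (Fin 3) ℂ, H.IsHomogeneous (m + 1) →
      (∀ P ∈ A, eval P.rep H = 0) → eval Q.rep H = 0) : Q ∈ A := by
  by_contra hQ
  choose! E h1 h2 h3 using hA
  -- each `E P` vanishes at `Q`
  have hEQ : ∀ P ∈ A, eval Q.rep (E P) = 0 := by
    intro P hP
    have hne : P ≠ Q := fun h => hQ (h ▸ hP)
    obtain ⟨a, ha, hb⟩ := exists_lin_sep Q P hne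
    have := h (E P * linForm 2 a) ((h1 P hP).mul (linForm_homog a)) (by
      intro R hR
      by_cases hRP : R = P
      · subst hRP; simp [hb]
      · simp [h3 P hP R hR hRP])
    rw [map_mul] at this
    exact (mul_eq_zero.1 this).resolve_right ha
  -- pick a form not vanishing at Q
  obtain ⟨a, ha⟩ := exists_lin_ne Q
  set L := linForm 2 a with hL
  have hLh := linForm_homog a
  let G : MvPolynomial (Fin 3) ℂ :=
    L ^ m - ∑ P ∈ A, C (eval P.rep (L ^ m) / eval P.rep (E P)) * E P
  have hGh : G.IsHomogeneous m := by
    apply IsHomogeneous.sub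
    · simpa using hLh.pow m
    · exact IsHomogeneous.sum _ _ _ fun P hP => (h1 P hP).C_mul _
  have hGA : ∀ P ∈ A, eval P.rep G = 0 := by
    intro P hP
    simp only [G, map_sub, map_sum, map_mul, eval_C]
    rw [Finset.sum_eq_single_of_mem P hP]
    · rw [div_mul_cancel₀ _ (h2 P hP), sub_self]
    · intro R hR hne
      rw [h3 R hR P hP hne.symm, mul_zero]
  have hGQ : eval Q.rep G ≠ 0 := by
    simp only [G, map_sub, map_sum, map_mul, eval_C]
    rw [Finset.sum_eq_zero (fun P hP => by rw [hEQ P hP, mul_zero]), sub_zero, map_pow]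
    exact pow_ne_zero _ ha
  have := h (G * L) (hGh.mul hLh) (fun P hP => by simp [hGA P hP])
  rw [map_mul] at this
  exact (mul_ne_zero hGQ ha) this

lemma unique_low {m : ℕ} {A B : Finset (Proj 2)} (hA : Separ m A) (c c' : Proj 2 → ℂ)
    (hc : ∀ P ∈ A, c P ≠ 0)
    (hrel : ∀ H : MvPolynomial (Fin 3) ℂ, H.IsHomogeneous (2 * m + 1) →
      ∑ P ∈ A, c P * eval P.rep H = ∑ P ∈ B, c' P * eval P.rep H)
    (hcard : B.card ≤ A.card) : B = A := by
  have hA1 : Separ (m + 1) A := sep_up hA 1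
  have hle : LinearMap.ker (evalMap 2 (m + 1) B) ≤ LinearMap.ker (evalMap 2 (m + 1) A) := by
    intro F hF
    have hFB : ∀ P ∈ B, eval P.rep F.1 = 0 := fun P hP =>
      congrFun (LinearMap.mem_ker.1 hF) ⟨P, hP⟩
    rw [LinearMap.mem_ker]
    ext ⟨P, hP⟩
    obtain ⟨E, h1, h2, h3⟩ := hA P hP
    have h := hrel (F.1 * E) (by
      have := (F.2 : F.1.IsHomogeneous (m + 1)).mul h1
      rwa [show m + 1 + m = 2 * m + 1 by ring] at this)
    rw [Finset.sum_eq_zero (s := B) (fun Q hQ => by rw [map_mul, hFB Q hQ]; ring),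
      Finset.sum_eq_single_of_mem P hP (fun Q hQ hne => by rw [map_mul, h3 Q hQ hne]; ring),
      map_mul] at h
    have := (mul_eq_zero.1 h).resolve_left (hc P hP)
    exact (mul_eq_zero.1 this).resolve_right h2
  have e1 := finrank_ker_of_sep hA1
  have e2 := finrank_ker_ge (m + 1) B
  have e3 := Submodule.finrank_mono hle
  have heq := Submodule.eq_of_le_of_finrank_le hle (by omega)
  have hsub : B ⊆ A := by
    intro Q hQ
    apply mem_of_vanish hA
    intro H hH hz
    have : (⟨H, hH⟩ : homogeneousSubmodule (Fin 3) ℂ (m + 1)) ∈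
        LinearMap.ker (evalMap 2 (m + 1) A) := by
      rw [LinearMap.mem_ker]; ext ⟨P, hP⟩; exact hz P hP
    rw [← heq] at this
    exact congrFun (LinearMap.mem_ker.1 this) ⟨Q, hQ⟩
  exact Finset.eq_of_subset_of_card_le hsub (by omega)

lemma pair_of_finrank {V : Type*} [AddCommGroup V] [Module ℂ V] (S : Submodule ℂ V)
    (U : Submodule ℂ S) (h : 2 ≤ Module.finrank ℂ U) :
    ∃ F G : S, F ∈ U ∧ G ∈ U ∧ LinearIndependent ℂ ![F.1, G.1] := by
  obtain ⟨f, hf⟩ := exists_linearIndependent_of_le_finrank h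
  refine ⟨(f 0).1, (f 1).1, (f 0).2, (f 1).2, ?_⟩
  have h1 := (hf.map' U.subtype U.ker_subtype).map' S.subtype S.ker_subtype
  have e : ![(f 0).1.1, (f 1).1.1] = S.subtype ∘ U.subtype ∘ f := by
    funext i
    fin_cases i <;> rfl
  rw [e]
  exact h1

lemma exists_pencil {m : ℕ} {A B : Finset (Proj 2)} (hA1 : Separ (m + 1) A)
    (hA0 : ∀ G : MvPolynomial (Fin 3) ℂ, G.IsHomogeneous m → (∀ P ∈ A, eval P.rep G = 0) → G = 0)
    (c c' : Proj 2 → ℂ) (hc : ∀ P ∈ A, c P ≠ 0)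
    (hrel : ∀ H : MvPolynomial (Fin 3) ℂ, H.IsHomogeneous (2 * m + 1) →
      ∑ P ∈ A, c P * eval P.rep H = ∑ P ∈ B, c' P * eval P.rep H)
    (hcard : B.card ≤ A.card) (hr : A.card ≤ (m + 2).choose 2 + m / 2) :
    ∃ F G : MvPolynomial (Fin 3) ℂ, F.IsHomogeneous (m + 1) ∧ G.IsHomogeneous (m + 1) ∧
      (∀ P ∈ A ∪ B, eval P.rep F = 0 ∧ eval P.rep G = 0) ∧
      LinearIndependent ℂ ![F, G] := by
  let S1 := homogeneousSubmodule (Fin 3) ℂ (m + 1)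
  let S0 := homogeneousSubmodule (Fin 3) ℂ m
  -- the transposed catalecticant
  let Φ : S0 →ₗ[ℂ] Module.Dual ℂ S1 := LinearMap.mk₂ ℂ
    (fun G F => ∑ P ∈ A, c P * (eval P.rep F.1 * eval P.rep G.1))
    (by intros; simp only [Submodule.coe_add, map_add, ← Finset.sum_add_distrib]
        exact Finset.sum_congr rfl fun _ _ => by ring)
    (by intros; simp only [Submodule.coe_smul, smul_eval, smul_eq_mul, Finset.mul_sum]
        exact Finset.sum_congr rfl fun _ _ => by ring)
    (by intros; simp only [Submodule.coe_add, map_add, ← Finset.sum_add_distrib]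
        exact Finset.sum_congr rfl fun _ _ => by ring)
    (by intros; simp only [Submodule.coe_smul, smul_eval, smul_eq_mul, Finset.mul_sum]
        exact Finset.sum_congr rfl fun _ _ => by ring)
  have hΦ : ∀ G F, Φ G F = ∑ P ∈ A, c P * (eval P.rep F.1 * eval P.rep G.1) := fun G F => rfl
  have hinj : Function.Injective Φ := by
    rw [← LinearMap.ker_eq_bot, eq_bot_iff]
    intro G hG
    rw [LinearMap.mem_ker] at hG
    rw [Submodule.mem_bot]
    ext1
    apply hA0 _ G.2
    intro P hP
    obtain ⟨E, h1, h2, h3⟩ := hA1 P hP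
    have := DFunLike.congr_fun hG ⟨E, h1⟩
    rw [hΦ, Finset.sum_eq_single_of_mem P hP
      (fun Q hQ hne => by rw [h3 Q hQ hne]; ring)] at this
    have := (mul_eq_zero.1 this).resolve_left (hc P hP)
    exact (mul_eq_zero.1 this).resolve_left h2
  let U : Submodule ℂ (Module.Dual ℂ S1) := LinearMap.range Φ
  have hU : Module.finrank ℂ U = (m + 2).choose 2 := by
    rw [LinearMap.finrank_range_of_inj hinj]
    show Module.finrank ℂ (homogeneousSubmodule (Fin 3) ℂ m) = _
    rw [finrank_hom 2, add_comm]
  let K : Submodule ℂ S1 := U.dualCoannihilator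
  have hK : Module.finrank ℂ U + Module.finrank ℂ K = (m + 3).choose 2 := by
    rw [Subspace.finrank_add_finrank_dualCoannihilator_eq]
    show Module.finrank ℂ (homogeneousSubmodule (Fin 3) ℂ (m + 1)) = _
    rw [finrank_hom 2]; congr 1; omega
  let IA : Submodule ℂ S1 := LinearMap.ker (evalMap 2 (m + 1) A)
  let IB : Submodule ℂ S1 := LinearMap.ker (evalMap 2 (m + 1) B)
  have eA : A.card + Module.finrank ℂ IA = (m + 1 + 2).choose 2 := finrank_ker_of_sep hA1
  have eB : (m + 1 + 2).choose 2 ≤ B.card + Module.finrank ℂ IB := finrank_ker_ge (m + 1) B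
  have hIA : ∀ F ∈ IA, ∀ P ∈ A, eval P.rep F.1 = 0 := fun F hF P hP =>
    congrFun (LinearMap.mem_ker.1 hF) ⟨P, hP⟩
  have hIB : ∀ F ∈ IB, ∀ P ∈ B, eval P.rep F.1 = 0 := fun F hF P hP =>
    congrFun (LinearMap.mem_ker.1 hF) ⟨P, hP⟩
  have hAK : IA ≤ K := by
    intro F hF
    rw [Submodule.mem_dualCoannihilator]
    rintro _ ⟨G, rfl⟩
    rw [hΦ]
    exact Finset.sum_eq_zero fun P hP => by rw [hIA F hF P hP]; ring
  have hBK : IB ≤ K := by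
    intro F hF
    rw [Submodule.mem_dualCoannihilator]
    rintro _ ⟨G, rfl⟩
    rw [hΦ]
    have := hrel (F.1 * G.1) (by
      have := (F.2 : F.1.IsHomogeneous (m + 1)).mul (G.2 : G.1.IsHomogeneous m)
      rwa [show m + 1 + m = 2 * m + 1 by ring] at this)
    simp only [map_mul] at this
    rw [this]
    exact Finset.sum_eq_zero fun P hP => by rw [hIB F hF P hP]; ring
  have hsup := Submodule.finrank_mono (sup_le hAK hBK)
  have hinf := Submodule.finrank_sup_add_finrank_inf_eq IA IB
  have hch : (m + 3).choose 2 = (m + 2) + (m + 2).choose 2 := by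
    rw [Nat.choose_succ_succ' (m + 2) 1, Nat.choose_one_right]
  have h2 : 2 ≤ Module.finrank ℂ (IA ⊓ IB : Submodule ℂ S1) := by
    have : m + 1 + 2 = m + 3 := by ring
    rw [this] at eA eB
    omega
  obtain ⟨F, G, hF, hG, hli⟩ := pair_of_finrank S1 (IA ⊓ IB) h2
  refine ⟨F.1, G.1, F.2, G.2, ?_, hli⟩
  intro P hP
  rcases Finset.mem_union.1 hP with h | h
  · exact ⟨hIA _ hF.1 P h, hIA _ hG.1 P h⟩
  · exact ⟨hIB _ hF.2 P h, hIB _ hG.2 P h⟩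

lemma unique_high {m : ℕ} {A B : Finset (Proj 2)} (hA1 : Separ (m + 1) A)
    (hN : (m + 2).choose 2 ≤ A.card)
    (hk : ∀ A' ⊆ A, A'.card ≤ (m + 2).choose 2 → Separ m A')
    (c c' : Proj 2 → ℂ) (hc : ∀ P ∈ A, c P ≠ 0)
    (hrel : ∀ H : MvPolynomial (Fin 3) ℂ, H.IsHomogeneous (2 * m + 1) →
      ∑ P ∈ A, c P * eval P.rep H = ∑ P ∈ B, c' P * eval P.rep H)
    (hcard : B.card ≤ A.card) (hr : A.card ≤ (m + 2).choose 2 + m / 2) : B = A := by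
  -- a form of degree `m` vanishing at `N` points of `A` is zero
  have hzero : ∀ A' ⊆ A, (m + 2).choose 2 ≤ A'.card → ∀ G : MvPolynomial (Fin 3) ℂ,
      G.IsHomogeneous m → (∀ P ∈ A', eval P.rep G = 0) → G = 0 := by
    intro A' hA' hcA G hG hz
    obtain ⟨A'', hs, hcA''⟩ := Finset.exists_subset_card_eq hcA
    have h1 := finrank_ker_of_sep (hk A'' (hs.trans hA') hcA''.le)
    have h2 : Module.finrank ℂ (LinearMap.ker (evalMap 2 m A'')) = 0 := by omega
    have h3 := Submodule.finrank_eq_zero.1 h2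
    have h4 : (⟨G, hG⟩ : homogeneousSubmodule (Fin 3) ℂ m) ∈ LinearMap.ker (evalMap 2 m A'') := by
      rw [LinearMap.mem_ker]; ext ⟨P, hP⟩; exact hz P (hs hP)
    rw [h3, Submodule.mem_bot] at h4
    exact congrArg Subtype.val h4
  obtain ⟨F, G, hF, hG, hFG, hli⟩ := exists_pencil hA1 (hzero A le_rfl hN) c c' hc hrel hcard hr
  have hF0 : F ≠ 0 := hli.ne_zero 0
  have hG0 : G ≠ 0 := hli.ne_zero 1
  obtain ⟨F', G', D, hrelp, rfl, rfl⟩ := UniqueFactorizationMonoid.exists_reduced_factors F hF0 G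
  obtain ⟨e, k, hek, hD, hF'⟩ := homog_of_mul hF hF0
  have hD0 : D ≠ 0 := left_ne_zero_of_mul hF0
  have hG'0 : G' ≠ 0 := right_ne_zero_of_mul hG0
  have hG' : G'.IsHomogeneous k := quot_homog hD hD0 (hek ▸ hG)
  have hk1 : 1 ≤ k := by
    by_contra hk0
    have hk0 : k = 0 := by omega
    subst hk0
    rw [← totalDegree_zero_iff_isHomogeneous] at hF' hG'
    rw [totalDegree_eq_zero_iff_eq_C] at hF' hG'
    set x := coeff 0 F'
    set y := coeff 0 G'
    have := LinearIndependent.pair_iff.1 hli y (-x) (by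
      rw [hF', hG']; simp only [smul_eq_C_mul, map_neg]; ring)
    apply hG'0
    rw [hG', this.1, map_zero]
  -- the residual set
  set Z := A ∪ B with hZ
  set W := Z.filter (fun P => eval P.rep D ≠ 0) with hW
  have hWsep : Separ (k + m) W := by
    apply sep_of_ci hk1 hF' hG' hG'0 hrelp W
    · intro P hP
      rw [hW, Finset.mem_filter] at hP
      have := hFG P hP.1
      simp only [map_mul] at this
      exact ⟨(mul_eq_zero.1 this.1).resolve_left hP.2, (mul_eq_zero.1 this.2).resolve_left hP.2⟩
    · omega
  -- extension by zero
  let lam : Proj 2 → ℂ := fun P => (if P ∈ A then c P else 0) - (if P ∈ B then c' P else 0)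
  have hlam : ∀ H : MvPolynomial (Fin 3) ℂ, H.IsHomogeneous (2 * m + 1) →
      ∑ P ∈ Z, lam P * eval P.rep H = 0 := by
    intro H hH
    have e1 : ∑ P ∈ Z, (if P ∈ A then c P else 0) * eval P.rep H = ∑ P ∈ A, c P * eval P.rep H := by
      rw [← Finset.sum_subset (Finset.subset_union_left : A ⊆ Z)]
      · exact Finset.sum_congr rfl fun P hP => by rw [if_pos hP]
      · intro P _ hP; rw [if_neg hP, zero_mul]
    have e2 : ∑ P ∈ Z, (if P ∈ B then c' P else 0) * eval P.rep H =
        ∑ P ∈ B, c' P * eval P.rep H := by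
      rw [← Finset.sum_subset (Finset.subset_union_right : B ⊆ Z)]
      · exact Finset.sum_congr rfl fun P hP => by rw [if_pos hP]
      · intro P _ hP; rw [if_neg hP, zero_mul]
    simp only [lam, sub_mul, Finset.sum_sub_distrib]
    rw [e1, e2, hrel H hH, sub_self]
  have hlamW : ∀ P ∈ W, lam P = 0 := by
    intro P hP
    obtain ⟨E, h1, h2, h3⟩ := hWsep P hP
    have hPW := hP
    rw [hW, Finset.mem_filter] at hPW
    have := hlam (D * E) (by
      have := hD.mul h1
      rwa [show e + (k + m) = 2 * m + 1 by omega] at this)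
    rw [Finset.sum_eq_single_of_mem P hPW.1] at this
    · have := (mul_eq_zero.1 this)
      apply this.resolve_right
      rw [map_mul]; exact mul_ne_zero hPW.2 h2
    · intro Q hQ hne
      rw [map_mul]
      by_cases hQD : eval Q.rep D = 0
      · rw [hQD]; ring
      · rw [h3 Q (Finset.mem_filter.2 ⟨hQ, hQD⟩) hne]; ring
  have hAB : ∀ P ∈ A, eval P.rep D ≠ 0 → P ∈ B ∧ c P = c' P := by
    intro P hP hPD
    have h := hlamW P (Finset.mem_filter.2 ⟨Finset.mem_union_left _ hP, hPD⟩)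
    simp only [lam, if_pos hP] at h
    by_cases hB : P ∈ B
    · rw [if_pos hB] at h; exact ⟨hB, sub_eq_zero.1 h⟩
    · rw [if_neg hB, sub_zero] at h; exact absurd h (hc P hP)
  set AD := A.filter (fun P => eval P.rep D = 0) with hAD
  set BD := B.filter (fun P => eval P.rep D = 0) with hBD
  set AN := A.filter (fun P => ¬ eval P.rep D = 0) with hAN
  set BN := B.filter (fun P => ¬ eval P.rep D = 0) with hBN
  have cA : AD.card + AN.card = A.card := Finset.card_filter_add_card_filter_not _
  have cB : BD.card + BN.card = B.card := Finset.card_filter_add_card_filter_not _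
  have hANB : AN ⊆ BN := by
    intro P hP
    rw [hAN, Finset.mem_filter] at hP
    exact Finset.mem_filter.2 ⟨(hAB P hP.1 hP.2).1, hP.2⟩
  have cN := Finset.card_le_card hANB
  have hADcard : AD.card ≤ (m + 2).choose 2 := by
    by_contra hlt
    obtain ⟨a, ha⟩ : ∃ L : MvPolynomial (Fin 3) ℂ, L = X 0 ^ (m - e) := ⟨_, rfl⟩
    have := hzero AD (Finset.filter_subset _ _) (by omega) (D * a) (by
      have h1 := hD.mul (isHomogeneous_X_pow (R := ℂ) (0 : Fin 3) (m - e))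
      rw [ha]
      rwa [show e + (m - e) = m by omega] at h1) (by
      intro P hP
      rw [hAD, Finset.mem_filter] at hP
      rw [map_mul, hP.2, zero_mul])
    rcases mul_eq_zero.1 this with h | h
    · exact hD0 h
    · rw [ha] at h; exact pow_ne_zero _ (X_ne_zero 0) h
  have hDeq : BD = AD := by
    apply unique_low (hk AD (Finset.filter_subset _ _) hADcard) c c'
      (fun P hP => hc P (Finset.filter_subset _ _ hP)) _ (by omega)
    intro H hH
    have h := hrel H hH
    rw [← Finset.sum_filter_add_sum_filter_not A (fun P => eval P.rep D = 0),
      ← Finset.sum_filter_add_sum_filter_not B (fun P => eval P.rep D = 0)] at h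
    have hN' : ∑ P ∈ AN, c P * eval P.rep H = ∑ P ∈ BN, c' P * eval P.rep H := by
      rw [← Finset.sum_subset hANB]
      · apply Finset.sum_congr rfl
        intro P hP
        rw [hAN, Finset.mem_filter] at hP
        rw [(hAB P hP.1 hP.2).2]
      · intro P hPB hPA
        rw [hBN, Finset.mem_filter] at hPB
        have hPA' : P ∉ A := fun h => hPA (Finset.mem_filter.2 ⟨h, hPB.2⟩)
        have h := hlamW P (Finset.mem_filter.2 ⟨Finset.mem_union_right _ hPB.1, hPB.2⟩)
        simp only [lam, if_neg hPA', if_pos hPB.1] at h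
        have : c' P = 0 := by linear_combination -h
        rw [this, zero_mul]
    linear_combination h - hN'
  symm
  apply Finset.eq_of_subset_of_card_le _ hcard
  intro P hP
  by_cases hPD : eval P.rep D = 0
  · have : P ∈ BD := hDeq ▸ Finset.mem_filter.2 ⟨hP, hPD⟩
    exact (Finset.mem_filter.1 this).1
  · exact (hAB P hP hPD).1

lemma kruskal_spec (j : ℕ) (A : Finset (Proj 2)) : ∀ A' ⊆ A, A'.card ≤ kruskalRank 2 j A →
    Separ j A' := by
  have hmem := Nat.sSup_mem (s := {k | k ≤ A.card ∧
    ∀ A' ⊆ A, A'.card ≤ k → LinearIndependent ℂ (fun P : A' => vero 2 j P.1)})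
    ⟨0, Nat.zero_le _, by
      intro A' _ h0
      have : A' = ∅ := Finset.card_eq_zero.1 (by omega)
      subst this
      exact linearIndependent_empty_type⟩ ⟨A.card, fun k hk => hk.1⟩
  intro A' hA' hle
  exact separ_of_linInd (hmem.2 A' hA' hle)

/-- Theorem (odd case, identifiability): if `d = 2m+1`, `m ≥ 2`,
`k_m(A) = min{binom(m+2,2), r}`, `h_A(m+1) = r` and `r ≤ binom(m+2,2) + ⌊m/2⌋`,
then `T` has rank `r` and is identifiable. -/
theorem stmt1 (m : ℕ) (hm : 2 ≤ m) (d : ℕ) (hd : d = 2 * m + 1)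
    (T : MvPolynomial (Fin 3) ℂ) (hT0 : T ≠ 0) (hTh : T.IsHomogeneous d)
    (A : Finset (Proj 2)) (hA : NRComputes 2 d A T) (r : ℕ) (hr : r = A.card)
    (hk : kruskalRank 2 m A = min (Nat.choose (m + 2) 2) r)
    (hh : hilbN 2 A (m + 1) = r)
    (hrb : r ≤ Nat.choose (m + 2) 2 + m / 2) :
    waringRank 2 d T = r ∧ Identifiable 2 d T := by

  have key : ∀ B : Finset (Proj 2), B.card ≤ r → Computes 2 d B T → B = A := by
    intro B hB hBT
    obtain ⟨c, hcT⟩ := (computes_iff d A T).1 hA.1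
    obtain ⟨c', hcT'⟩ := (computes_iff d B T).1 hBT
    have hc : ∀ P ∈ A, c P ≠ 0 := by
      intro P hP h0
      apply hA.2 (A.erase P) (Finset.erase_ssubset hP)
      rw [computes_iff]
      refine ⟨c, ?_⟩
      rw [← hcT, ← Finset.add_sum_erase A _ hP, h0, zero_smul, zero_add]
    have hrel : ∀ H : MvPolynomial (Fin 3) ℂ, H.IsHomogeneous (2 * m + 1) →
        ∑ P ∈ A, c P * eval P.rep H = ∑ P ∈ B, c' P * eval P.rep H := by
      let cA : Proj 2 → ℂ := fun P => if P ∈ A then c P else 0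
      let cB : Proj 2 → ℂ := fun P => if P ∈ B then c' P else 0
      have h0 : ∑ P ∈ A ∪ B, (cA P - cB P) • vero 2 d P = 0 := by
        simp only [sub_smul, Finset.sum_sub_distrib]
        rw [← Finset.sum_subset (Finset.subset_union_left : A ⊆ A ∪ B),
          ← Finset.sum_subset (Finset.subset_union_right : B ⊆ A ∪ B),
          Finset.sum_congr rfl (g := fun P => c P • vero 2 d P), hcT,
          Finset.sum_congr rfl (g := fun P => c' P • vero 2 d P), hcT', sub_self]
        · intro P hP; simp [cB, hP]
        · intro P hP; simp [cA, hP]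
        · intro P _ hP; simp [cB, hP]
        · intro P _ hP; simp [cA, hP]
      intro H hH
      have h1 := (vero_rel_iff d _ _).1 h0 H (hd ▸ hH)
      simp only [sub_mul, Finset.sum_sub_distrib] at h1
      rw [← Finset.sum_subset (Finset.subset_union_left : A ⊆ A ∪ B),
          ← Finset.sum_subset (Finset.subset_union_right : B ⊆ A ∪ B),
          show ∑ P ∈ A, cA P * eval P.rep H = ∑ P ∈ A, c P * eval P.rep H from
            Finset.sum_congr rfl fun P hP => by simp [cA, hP],
          show ∑ P ∈ B, cB P * eval P.rep H = ∑ P ∈ B, c' P * eval P.rep H from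
            Finset.sum_congr rfl fun P hP => by simp [cB, hP]] at h1
      · exact sub_eq_zero.1 h1
      · intro P _ hP; simp [cB, hP]
      · intro P _ hP; simp [cA, hP]
    have hkr := kruskal_spec m A
    rw [hk] at hkr
    subst hr
    rcases le_total A.card ((m + 2).choose 2) with h | h
    · exact unique_low (hkr A le_rfl (by omega)) c c' hc hrel hB
    · exact unique_high (separ_of_hilb hh) h (fun A' hA' hle => hkr A' hA' (by omega))
        c c' hc hrel hB hrb
  have hrank : waringRank 2 d T = r := by
    apply le_antisymm
    · exact Nat.sInf_le ⟨A, hr.symm, hA.1⟩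
    · obtain ⟨B, hB, hBT⟩ := Nat.sInf_mem
        (s := {r | ∃ A : Finset (Proj 2), A.card = r ∧ Computes 2 d A T}) ⟨r, A, hr.symm, hA.1⟩
      by_contra hlt
      have hle : B.card ≤ r := by
        rw [hB]; exact (not_le.1 hlt).le
      have := key B hle hBT
      subst this
      apply hlt
      rw [hr, hB]; exact le_rfl
  refine ⟨hrank, A, ⟨by rw [hrank, hr], hA.1⟩, ?_⟩
  rintro B ⟨hB, hBT⟩
  exact key B (by rw [hB, hrank]) hBT
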